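/- arXiv:2302.04839 — 8 statements merged into one kernel-verified Lean document; each statement's English description precedes it below -/
import Mathlib

section
/- Let E be a real inner product space, g ∈ E, and d_0, …, d_{T−1} ∈ E nonzero vectors with ⟪g, d_j⟫ ≥ 0 for all j. Let α_0, …, α_{T−1} ≥ 0 be nonnegative reals such that s := Σ_{j=0}^{T−1} α_j d_j ≠ 0. Then ⟪g, s⟫ / ‖s‖ ≥ min_{0 ≤ j ≤ T−1} ⟪g, d_j⟫ / ‖d_j‖. -/
open scoped RealInnerProductSpace

/-- The normalized slope of a conic combination of ascent directions is bounded
below by the worst normalized slope of the individual directions. -/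
theorem slope_of_conic_combination
    {E : Type*} [NormedAddCommGroup E] [InnerProductSpace ℝ E]
    (T : ℕ) (g : E) (d : Fin T → E)
    (hd : ∀ j, d j ≠ 0)
    (hgd : ∀ j, 0 ≤ ⟪g, d j⟫)
    (α : Fin T → ℝ) (hα : ∀ j, 0 ≤ α j)
    (hs : (∑ j, α j • d j) ≠ 0) :
    (⨅ j : Fin T, ⟪g, d j⟫ / ‖d j‖) ≤
      ⟪g, ∑ j, α j • d j⟫ / ‖∑ j, α j • d j‖ := by
  set m := ⨅ j : Fin T, ⟪g, d j⟫ / ‖d j‖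
  have hm : 0 ≤ m := Real.iInf_nonneg fun j => div_nonneg (hgd j) (norm_nonneg _)
  have hmd (j : Fin T) : m * ‖d j‖ ≤ ⟪g, d j⟫ :=
    (le_div_iff₀ (norm_pos_iff.2 (hd j))).1 (ciInf_le (Set.finite_range _).bddBelow j)
  rw [le_div_iff₀ (norm_pos_iff.2 hs)]
  calc m * ‖∑ j, α j • d j‖ ≤ m * ∑ j, ‖α j • d j‖ := by
        gcongr
        exact norm_sum_le _ _
    _ = ∑ j, α j * (m * ‖d j‖) := by
        rw [Finset.mul_sum]
        refine Finset.sum_congr rfl fun j _ => ?_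
        rw [norm_smul_of_nonneg (hα j), mul_left_comm]
    _ ≤ ∑ j, α j * ⟪g, d j⟫ :=
        Finset.sum_le_sum fun j _ => mul_le_mul_of_nonneg_left (hmd j) (hα j)
    _ = ⟪g, ∑ j, α j • d j⟫ := by simp only [inner_sum, real_inner_smul_right]
end

section
/- Let E be a real inner product space, g, y_0 ∈ E, and L > 0. Let y, w ∈ E be such that w = y + Σ_{i=0}^{N−1} α_i d_i for some vectors d_i ∈ E with ⟪g, d_i⟫ ≥ 0 and reals α_i ≥ 0. If L·‖w − y_0‖² = ⟪g, w − y_0⟫ and L·‖y − y_0‖² ≤ ⟪g, y − y_0⟫, then ‖y − y_0‖ ≤ ‖w − y_0‖. -/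
open scoped RealInnerProductSpace

/-- If the final point `w` of a chain of ascent steps starting at `y` lies on the
boundary of the ball `B̄ = {z : L‖z - y₀‖² ≤ ⟪g, z - y₀⟫}` and an intermediate point
`y` lies in `B̄`, then `w` is at least as far from `y₀` as `y`. -/
theorem chain_endpoint_farther
    {E : Type*} [NormedAddCommGroup E] [InnerProductSpace ℝ E]
    (g y₀ : E) (L : ℝ) (hL : 0 < L)
    (N : ℕ) (d : Fin N → E) (α : Fin N → ℝ)
    (hgd : ∀ i, 0 ≤ ⟪g, d i⟫) (hα : ∀ i, 0 ≤ α i)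
    (y w : E) (hw : w = y + ∑ i, α i • d i)
    (hwb : L * ‖w - y₀‖ ^ 2 = ⟪g, w - y₀⟫)
    (hyb : L * ‖y - y₀‖ ^ 2 ≤ ⟪g, y - y₀⟫) :
    ‖y - y₀‖ ≤ ‖w - y₀‖ := by
  have hsum : 0 ≤ ⟪g, ∑ i, α i • d i⟫ := by
    rw [inner_sum]
    refine Finset.sum_nonneg fun i _ => ?_
    rw [real_inner_smul_right]
    exact mul_nonneg (hα i) (hgd i)
  have hsplit : ⟪g, w - y₀⟫ = ⟪g, y - y₀⟫ + ⟪g, ∑ i, α i • d i⟫ := by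
    rw [← inner_add_right, hw, add_sub_right_comm]
  have hsq : L * ‖y - y₀‖ ^ 2 ≤ L * ‖w - y₀‖ ^ 2 := by linarith
  exact (pow_le_pow_iff_left₀ (norm_nonneg _) (norm_nonneg _) two_ne_zero).mp
    (le_of_mul_le_mul_left hsq hL)
end

section
/- Let E be a real inner product space, C ⊆ E a convex set, and f : E → ℝ differentiable with gradient ∇f Lipschitz continuous with constant L > 0. Let {x_k} be a sequence in C satisfying L·‖x_{k+1} − x_k‖² ≤ ⟪−∇f(x_k), x_{k+1} − x_k⟫ for all k ≥ 0, and let U_0 be the connected component of {y ∈ C : f(y) ≤ f(x_0)} containing x_0. Then: (i) f(x_{k+1}) ≤ f(x_k) − (L/2)·‖x_{k+1} − x_k‖² for all k; (ii) x_k ∈ U_0 for all k; (iii) if x_* ∈ C satisfies f(x_*) ≤ f(y) for all y ∈ U_0, then f(x_*) ≤ f(x_k) ≤ f(x_0) for all k. -/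
open scoped RealInnerProductSpace

/-- The descent lemma: a function with `L`-Lipschitz gradient lies below its quadratic upper
model. -/
theorem le_quadratic_of_lipschitz_gradient
    {E : Type*} [NormedAddCommGroup E] [InnerProductSpace ℝ E] [CompleteSpace E]
    {f : E → ℝ} {f' : E → E} {L : ℝ}
    (hdiff : ∀ z : E, HasGradientAt f (f' z) z)
    (hlip : ∀ z w : E, ‖f' z - f' w‖ ≤ L * ‖z - w‖) (a d : E) :
    f (a + d) ≤ f a + ⟪f' a, d⟫ + L / 2 * ‖d‖ ^ 2 := by
  have hφ : ∀ t : ℝ, HasDerivAt (fun t : ℝ => f (a + t • d)) ⟪f' (a + t • d), d⟫ t := by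
    intro t
    have hline : HasDerivAt (fun t : ℝ => a + t • d) d t := by
      simpa using ((hasDerivAt_id t).smul_const d).const_add a
    exact ((hdiff (a + t • d)).hasFDerivAt.comp_hasDerivAt t hline).congr_deriv (by simp)
  have hB : ∀ t : ℝ, HasDerivAt (fun t : ℝ => f a + t * ⟪f' a, d⟫ + L / 2 * ‖d‖ ^ 2 * t ^ 2)
      (⟪f' a, d⟫ + L * ‖d‖ ^ 2 * t) t := by
    intro t
    have h := (((hasDerivAt_id t).mul_const ⟪f' a, d⟫).const_add (f a)).add
      ((hasDerivAt_pow 2 t).const_mul (L / 2 * ‖d‖ ^ 2))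
    refine h.congr_deriv ?_
    norm_num
    ring
  have hbound : ∀ t ∈ Set.Ico (0 : ℝ) 1,
      ⟪f' (a + t • d), d⟫ ≤ ⟪f' a, d⟫ + L * ‖d‖ ^ 2 * t := by
    intro t ht
    have hgrad : ‖f' (a + t • d) - f' a‖ ≤ L * (t * ‖d‖) := by
      simpa [norm_smul, abs_of_nonneg ht.1] using hlip (a + t • d) a
    have hinner := real_inner_le_norm (f' (a + t • d) - f' a) d
    rw [inner_sub_left] at hinner
    nlinarith [mul_le_mul_of_nonneg_right hgrad (norm_nonneg d)]
  have h := image_le_of_deriv_right_le_deriv_boundary (a := 0) (b := 1)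
    (fun t _ => (hφ t).continuousAt.continuousWithinAt)
    (fun t _ => (hφ t).hasDerivWithinAt) (by simp)
    (fun t _ => (hB t).continuousAt.continuousWithinAt)
    (fun t _ => (hB t).hasDerivWithinAt) hbound (Set.right_mem_Icc.2 zero_le_one)
  simpa using h

/-- Monotone decrease and confinement of the iterates: if every step lies in the
descent ball of the current iterate, the objective values decrease by a sufficient
amount, all iterates stay in the connected component `U₀` of the initial sublevel
set containing `x₀`, and the objective values stay in `[f(x_*), f(x₀)]` whenever
`f(x_*)` is a minimum of `f` on `U₀`. -/
theorem iterates_stay_in_component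
    {E : Type*} [NormedAddCommGroup E] [InnerProductSpace ℝ E] [CompleteSpace E]
    (C : Set E) (hC : Convex ℝ C)
    (f : E → ℝ) (f' : E → E) (L : ℝ) (hL : 0 < L)
    (hdiff : ∀ z : E, HasGradientAt f (f' z) z)
    (hlip : ∀ z w : E, ‖f' z - f' w‖ ≤ L * ‖z - w‖)
    (x : ℕ → E) (hxC : ∀ k, x k ∈ C)
    (hstep : ∀ k, L * ‖x (k + 1) - x k‖ ^ 2 ≤ ⟪-f' (x k), x (k + 1) - x k⟫) :
    (∀ k, f (x (k + 1)) ≤ f (x k) - L / 2 * ‖x (k + 1) - x k‖ ^ 2) ∧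
    (∀ k, x k ∈ connectedComponentIn {y ∈ C | f y ≤ f (x 0)} (x 0)) ∧
    (∀ xstar ∈ C,
      (∀ y ∈ connectedComponentIn {y ∈ C | f y ≤ f (x 0)} (x 0), f xstar ≤ f y) →
      ∀ k, f xstar ≤ f (x k) ∧ f (x k) ≤ f (x 0)) := by
  have hmodel : ∀ k, ∀ t : ℝ, 0 ≤ t → f (x k + t • (x (k + 1) - x k)) ≤
      f (x k) - L * ‖x (k + 1) - x k‖ ^ 2 * t + L / 2 * ‖x (k + 1) - x k‖ ^ 2 * t ^ 2 := by
    intro k t ht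
    have h := le_quadratic_of_lipschitz_gradient hdiff hlip (x k) (t • (x (k + 1) - x k))
    rw [inner_smul_right, norm_smul, mul_pow, Real.norm_eq_abs, sq_abs] at h
    have hs := hstep k
    rw [inner_neg_left] at hs
    nlinarith [mul_le_mul_of_nonneg_left hs ht]
  have hdecr : ∀ k, f (x (k + 1)) ≤ f (x k) - L / 2 * ‖x (k + 1) - x k‖ ^ 2 := by
    intro k
    have h := hmodel k 1 zero_le_one
    rw [one_smul, add_sub_cancel] at h
    linarith
  have hanti : Antitone (fun k => f (x k)) := antitone_nat_of_succ_le fun k =>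
    (hdecr k).trans (sub_le_self _ (by positivity))
  have hsublevel : ∀ k, f (x k) ≤ f (x 0) := fun k => hanti (Nat.zero_le k)
  have hsegment : ∀ k, segment ℝ (x k) (x (k + 1)) ⊆ {y ∈ C | f y ≤ f (x 0)} := by
    intro k y hy
    refine ⟨hC.segment_subset (hxC k) (hxC (k + 1)) hy, ?_⟩
    rw [segment_eq_image'] at hy
    obtain ⟨t, ⟨ht0, ht1⟩, rfl⟩ := hy
    have hgain : 0 ≤ L * ‖x (k + 1) - x k‖ ^ 2 * (t * (2 - t)) :=
      mul_nonneg (by positivity) (mul_nonneg ht0 (by linarith))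
    linarith [hmodel k t ht0, hsublevel k]
  have hmem : ∀ k, x k ∈ connectedComponentIn {y ∈ C | f y ≤ f (x 0)} (x 0) := by
    intro k
    induction k with
    | zero => exact mem_connectedComponentIn ⟨hxC 0, le_rfl⟩
    | succ k ih =>
      rw [connectedComponentIn_eq ih]
      exact (convex_segment (x k) (x (k + 1))).isPreconnected.subset_connectedComponentIn
        (left_mem_segment ℝ _ _) (hsegment k) (right_mem_segment ℝ _ _)
  exact ⟨hdecr, hmem, fun xstar _ hmin k => ⟨hmin (x k) (hmem k), hsublevel k⟩⟩
end

section
/- Let {a_k}_{k≥0} be a nonincreasing sequence of real numbers, a_* ∈ ℝ, and q ∈ [0,1) such that a_* ≤ a_k and a_k − a_* ≤ q^k·(a_0 − a_*) for all k ≥ 0. Then for every k ≥ 0 the series Σ_{i=k}^{∞} √(a_i − a_{i+1}) converges and Σ_{i=k}^{∞} √(a_i − a_{i+1}) ≤ √(a_0 − a_*) · q^{k/2} / (1 − √q). -/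
/-- Tail-length estimate: from the geometric decrease of the objective gap, the sum
of square roots of consecutive decreases is bounded by a geometric series with
ratio `√q`. -/
theorem tail_length_estimate
    (a : ℕ → ℝ) (astar q : ℝ)
    (hq : q ∈ Set.Ico (0 : ℝ) 1)
    (hmono : ∀ k, a (k + 1) ≤ a k)
    (hlb : ∀ k, astar ≤ a k)
    (hgeo : ∀ k, a k - astar ≤ q ^ k * (a 0 - astar)) :
    ∀ k, Summable (fun i => Real.sqrt (a (k + i) - a (k + i + 1))) ∧
      ∑' i, Real.sqrt (a (k + i) - a (k + i + 1)) ≤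
        Real.sqrt (a 0 - astar) * (Real.sqrt q) ^ k / (1 - Real.sqrt q) := by
  intro k
  have hq_sqrt : √q < 1 := by
    rw [Real.sqrt_lt' one_pos]
    simpa using hq.2
  have hterm (i : ℕ) :
      √(a (k + i) - a (k + i + 1)) ≤ √(a 0 - astar) * √q ^ k * √q ^ i := by
    have hpow : √(q ^ (k + i)) = √q ^ (k + i) := by
      rw [Real.sqrt_eq_iff_mul_self_eq (pow_nonneg hq.1 _) (by positivity), ← mul_pow,
        Real.mul_self_sqrt hq.1]
    calc √(a (k + i) - a (k + i + 1)) ≤ √(q ^ (k + i) * (a 0 - astar)) :=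
          Real.sqrt_le_sqrt (by linarith [hgeo (k + i), hlb (k + i + 1)])
      _ = √(a 0 - astar) * √q ^ k * √q ^ i := by
          rw [Real.sqrt_mul (pow_nonneg hq.1 _), hpow]
          ring
  have hsum := (hasSum_geometric_of_lt_one (Real.sqrt_nonneg q) hq_sqrt).mul_left
    (√(a 0 - astar) * √q ^ k)
  have hsummable := Summable.of_nonneg_of_le (fun i => Real.sqrt_nonneg _) hterm hsum.summable
  refine ⟨hsummable, ?_⟩
  rw [div_eq_mul_inv, ← hsum.tsum_eq]
  exact hsummable.tsum_le_tsum hterm hsum.summable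
end

section
/- Let E be a complete real inner product space (real Hilbert space), L > 0, q ∈ [0,1), and a_* ∈ ℝ. Let {x_k} be a sequence in E and {a_k} a nonincreasing real sequence with a_* ≤ a_k, a_k − a_* ≤ q^k·(a_0 − a_*), and ‖x_{k+1} − x_k‖ ≤ √((2/L)·(a_k − a_{k+1})) for all k ≥ 0. Then {x_k} converges to some point x̃_* ∈ E and, for all k ≥ 0, ‖x_k − x̃_*‖ ≤ √(2(a_0 − a_*)/L) · q^{k/2} / (1 − √q). -/
/-- Iterate convergence bound: in a real Hilbert space, a sequence whose step sizes
are controlled by the square roots of geometrically decreasing objective decreases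
converges, with a geometric bound on the distance to the limit. -/
theorem iterate_convergence
    {E : Type*} [NormedAddCommGroup E] [InnerProductSpace ℝ E] [CompleteSpace E]
    (L q astar : ℝ) (hL : 0 < L) (hq : q ∈ Set.Ico (0 : ℝ) 1)
    (x : ℕ → E) (a : ℕ → ℝ)
    (hmono : ∀ k, a (k + 1) ≤ a k)
    (hlb : ∀ k, astar ≤ a k)
    (hgeo : ∀ k, a k - astar ≤ q ^ k * (a 0 - astar))
    (hstep : ∀ k, ‖x (k + 1) - x k‖ ≤ Real.sqrt (2 / L * (a k - a (k + 1)))) :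
    ∃ xlim : E, Filter.Tendsto x Filter.atTop (nhds xlim) ∧
      ∀ k, ‖x k - xlim‖ ≤
        Real.sqrt (2 * (a 0 - astar) / L) * (Real.sqrt q) ^ k / (1 - Real.sqrt q) := by
  have hr : √q < 1 := by
    rw [Real.sqrt_lt' one_pos, one_pow]
    exact hq.2
  have hdist : ∀ k, dist (x k) (x (k + 1)) ≤ √(2 * (a 0 - astar) / L) * √q ^ k := by
    intro k
    have hdecrease : a k - a (k + 1) ≤ q ^ k * (a 0 - astar) := by
      linarith [hgeo k, hlb (k + 1)]
    rw [dist_comm, dist_eq_norm]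
    calc ‖x (k + 1) - x k‖
        ≤ √(2 / L * (a k - a (k + 1))) := hstep k
      _ ≤ √(2 / L * (q ^ k * (a 0 - astar))) := by gcongr
      _ = √(2 * (a 0 - astar) / L * (√q ^ k) ^ 2) := by
          rw [← pow_mul, mul_comm k, pow_mul, Real.sq_sqrt hq.1]
          ring_nf
      _ = √(2 * (a 0 - astar) / L) * √q ^ k := by
          rw [Real.sqrt_mul' _ (by positivity), Real.sqrt_sq (by positivity)]
  obtain ⟨xlim, hlim⟩ :=
    cauchySeq_tendsto_of_complete (cauchySeq_of_le_geometric _ _ hr hdist)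
  refine ⟨xlim, hlim, fun k ↦ ?_⟩
  rw [← dist_eq_norm]
  exact dist_le_of_le_geometric_of_tendsto _ _ hr hdist hlim k
end

section
/- Let m ≥ 1 be an integer, and let L, μ, τ be reals with 0 < μ ≤ L and 0 < τ ≤ 1. Let {a_k}, {d_k} be real sequences and f_* ∈ ℝ such that for every k ≥ 0: f_* ≤ d_k ≤ a_k, a_k − a_{k+1} ≥ (1/(3m))·(a_k − d_k), and a_k − a_{k+1} ≥ (μτ²/(2mL(1+τ²)))·(d_k − f_*). Then, with q = 1 − μτ²/(4mL(1+τ²)), one has q ∈ (0,1) and a_k − f_* ≤ q^k·(a_0 − f_*) for all k ≥ 0. -/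
/-- Linear convergence rate of the block-coordinate method: the two per-step
inequalities imply a geometric decrease of the optimality gap with factor
`q = 1 - μτ²/(4mL(1+τ²))`. -/
theorem linear_convergence_rate
    (m : ℕ) (hm : 1 ≤ m) (L μ τ : ℝ)
    (hμ : 0 < μ) (hμL : μ ≤ L) (hτ0 : 0 < τ) (hτ1 : τ ≤ 1)
    (a d : ℕ → ℝ) (fstar : ℝ)
    (h1 : ∀ k, fstar ≤ d k) (h2 : ∀ k, d k ≤ a k)
    (h3 : ∀ k, a k - a (k + 1) ≥ 1 / (3 * (m : ℝ)) * (a k - d k))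
    (h4 : ∀ k, a k - a (k + 1) ≥
      μ * τ ^ 2 / (2 * (m : ℝ) * L * (1 + τ ^ 2)) * (d k - fstar)) :
    (1 - μ * τ ^ 2 / (4 * (m : ℝ) * L * (1 + τ ^ 2))) ∈ Set.Ioo (0 : ℝ) 1 ∧
    ∀ k, a k - fstar ≤
      (1 - μ * τ ^ 2 / (4 * (m : ℝ) * L * (1 + τ ^ 2))) ^ k * (a 0 - fstar) := by
  obtain ⟨c, hc⟩ : ∃ c, c = μ * τ ^ 2 / (L * (1 + τ ^ 2)) := ⟨_, rfl⟩
  have hL : 0 < L := hμ.trans_le hμL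
  have hm1 : (1 : ℝ) ≤ m := by exact_mod_cast hm
  have hm0 : (0 : ℝ) < m := by linarith
  have hc0 : 0 < c := by rw [hc]; positivity
  have hc1 : c ≤ 1 / 2 := by
    have hτ2 : τ ^ 2 ≤ 1 := pow_le_one₀ hτ0.le hτ1
    rw [hc, div_le_div_iff₀ (by positivity) two_pos]
    nlinarith [mul_le_mul_of_nonneg_right hμL (sq_nonneg τ)]
  have hrate : μ * τ ^ 2 / (4 * (m : ℝ) * L * (1 + τ ^ 2)) = 3 * c / 4 * (1 / (3 * m)) := by
    rw [hc]; field_simp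
  have hrate' : μ * τ ^ 2 / (2 * (m : ℝ) * L * (1 + τ ^ 2)) =
      2 * (3 * c / 4 * (1 / (3 * m))) := by
    rw [hc]; field_simp; norm_num
  simp only [hrate'] at h4
  rw [hrate]
  obtain ⟨r, hr⟩ : ∃ r, r = 1 / (3 * (m : ℝ)) := ⟨_, rfl⟩
  have hr0 : 0 < r := by rw [hr]; positivity
  have hr1 : r ≤ 1 := by
    rw [hr, div_le_one (by positivity)]
    linarith
  simp only [← hr] at h3 h4 ⊢
  have hlt : 3 * c / 4 * r < 1 := by nlinarith
  refine ⟨⟨by linarith, by linarith [show 0 < 3 * c / 4 * r by positivity]⟩, fun k ↦ ?_⟩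
  induction k with
  | zero => simp
  | succ k ih =>
    have hdecr : 0 ≤ a k - a (k + 1) :=
      (mul_nonneg hr0.le (sub_nonneg.2 (h2 k))).trans (h3 k)
    calc a (k + 1) - fstar
        ≤ (1 - 3 * c / 4 * r) * (a k - fstar) := by
          have hA := mul_le_mul_of_nonneg_left (h3 k) (show 0 ≤ 3 * c / 4 by positivity)
          have hD := mul_le_mul_of_nonneg_right (show 3 * c / 4 ≤ 1 / 2 by linarith) hdecr
          linarith [h4 k]
      _ ≤ (1 - 3 * c / 4 * r) * ((1 - 3 * c / 4 * r) ^ k * (a 0 - fstar)) :=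
          mul_le_mul_of_nonneg_left ih (by linarith)
      _ = (1 - 3 * c / 4 * r) ^ (k + 1) * (a 0 - fstar) := by ring
end

section
/- Let E be a real inner product space, f : E → ℝ differentiable with gradient ∇f Lipschitz continuous with constant L > 0, and let x, x̄, y ∈ E with g := −∇f(x). If L·‖x̄ − x‖² ≤ ⟪g, x̄ − x⟫ and ⟪g, x̄ − x⟫ ≤ ⟪g, y − x⟫, then (1/2)·⟪g, y − x⟫ ≥ (1/3)·( f(x) − f(x̄) ). -/
open scoped RealInnerProductSpace

/-- A function with `L`-Lipschitz gradient lies above its linearization minus the quadratic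
`L / 2 * ‖w - z‖ ^ 2`. -/
theorem add_inner_sub_le_of_lipschitz_gradient
    {E : Type*} [NormedAddCommGroup E] [InnerProductSpace ℝ E] [CompleteSpace E]
    {f : E → ℝ} {f' : E → E} {L : ℝ}
    (hdiff : ∀ z : E, HasGradientAt f (f' z) z)
    (hlip : ∀ z w : E, ‖f' z - f' w‖ ≤ L * ‖z - w‖) (z w : E) :
    f z + ⟪f' z, w - z⟫ - L / 2 * ‖w - z‖ ^ 2 ≤ f w := by
  set d := w - z with hd
  have hline (t : ℝ) : HasDerivAt (fun t : ℝ => z + t • d) d t := by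
    simpa using ((hasDerivAt_id t).smul_const d).const_add z
  have hf (t : ℝ) : HasDerivAt (fun t : ℝ => -f (z + t • d)) (-⟪f' (z + t • d), d⟫) t := by
    have h := (hdiff (z + t • d)).hasFDerivAt.comp_hasDerivAt t (hline t)
    rw [InnerProductSpace.toDual_apply_apply] at h
    exact h.neg
  have hB (t : ℝ) : HasDerivAt (fun t : ℝ => -f z - t * ⟪f' z, d⟫ + L / 2 * ‖d‖ ^ 2 * t ^ 2)
      (-⟪f' z, d⟫ + L * ‖d‖ ^ 2 * t) t := by
    refine ((((hasDerivAt_id t).mul_const ⟪f' z, d⟫).const_sub (-f z)).add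
      ((hasDerivAt_pow 2 t).const_mul (L / 2 * ‖d‖ ^ 2))).congr_deriv ?_
    norm_num
    ring
  have hbound : ∀ t ∈ Set.Ico (0 : ℝ) 1,
      -⟪f' (z + t • d), d⟫ ≤ -⟪f' z, d⟫ + L * ‖d‖ ^ 2 * t := by
    intro t ht
    have hnorm : ‖f' z - f' (z + t • d)‖ ≤ L * (t * ‖d‖) := by
      simpa [norm_smul, abs_of_nonneg ht.1] using hlip z (z + t • d)
    have hinner : ⟪f' z - f' (z + t • d), d⟫ ≤ L * (t * ‖d‖) * ‖d‖ :=
      (real_inner_le_norm _ _).trans (by gcongr)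
    rw [inner_sub_left] at hinner
    linarith
  have h := image_le_of_deriv_right_le_deriv_boundary
    (fun t _ => (hf t).continuousAt.continuousWithinAt)
    (fun t _ => (hf t).hasDerivWithinAt) (by simp)
    (fun t _ => (hB t).continuousAt.continuousWithinAt)
    (fun t _ => (hB t).hasDerivWithinAt) hbound (Set.right_mem_Icc.2 zero_le_one)
  have hw : z + (1 : ℝ) • d = w := by simp [hd]
  rw [hw] at h
  linarith

/-- Inequality (21) of Lemma 8.3: the linearized progress at the SSC output `y`
bounds a third of the decrease from `x` to the intermediate point `x̄`. -/
theorem linearized_progress_bound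
    {E : Type*} [NormedAddCommGroup E] [InnerProductSpace ℝ E] [CompleteSpace E]
    (f : E → ℝ) (f' : E → E) (L : ℝ) (hL : 0 < L)
    (hdiff : ∀ z : E, HasGradientAt f (f' z) z)
    (hlip : ∀ z w : E, ‖f' z - f' w‖ ≤ L * ‖z - w‖)
    (x xbar y : E)
    (hball : L * ‖xbar - x‖ ^ 2 ≤ ⟪-f' x, xbar - x⟫)
    (hmono : ⟪-f' x, xbar - x⟫ ≤ ⟪-f' x, y - x⟫) :
    1 / 2 * ⟪-f' x, y - x⟫ ≥ 1 / 3 * (f x - f xbar) := by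
  have h := add_inner_sub_le_of_lipschitz_gradient hdiff hlip x xbar
  simp only [inner_neg_left] at *
  linarith
end

section
/- Let E be a real inner product space, f : E → ℝ differentiable with gradient ∇f Lipschitz continuous with constant L > 0, and let x, x̄, y ∈ E with g := −∇f(x). Assume L·‖y − x‖² ≤ ⟪g, y − x⟫, L·‖x̄ − x‖² ≤ ⟪g, x̄ − x⟫, and ⟪g, x̄ − x⟫ ≤ ⟪g, y − x⟫. Then f(x) − f(y) ≥ (1/3)·( f(x) − f(x̄) ). -/
open scoped RealInnerProductSpace

/-- The quadratic bound on the first-order Taylor remainder of a function with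
`L`-Lipschitz gradient. -/
theorem abs_sub_sub_inner_le_of_lipschitz_gradient
    {E : Type*} [NormedAddCommGroup E] [InnerProductSpace ℝ E] [CompleteSpace E]
    {f : E → ℝ} {f' : E → E} {L : ℝ}
    (hdiff : ∀ z : E, HasGradientAt f (f' z) z)
    (hlip : ∀ z w : E, ‖f' z - f' w‖ ≤ L * ‖z - w‖) (x y : E) :
    |f y - f x - ⟪f' x, y - x⟫| ≤ L / 2 * ‖y - x‖ ^ 2 := by
  set d := y - x with hd
  have hderiv (t : ℝ) : HasDerivAt (fun s : ℝ ↦ f (x + s • d) - f x - s * ⟪f' x, d⟫)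
      ⟪f' (x + t • d) - f' x, d⟫ t := by
    have hline : HasDerivAt (fun s : ℝ ↦ x + s • d) d t := by
      simpa using ((hasDerivAt_id t).smul_const d).const_add x
    have hcomp := (hdiff (x + t • d)).hasFDerivAt.comp_hasDerivAt t hline
    have h := (hcomp.sub_const (f x)).sub ((hasDerivAt_id t).mul_const ⟪f' x, d⟫)
    exact h.congr_deriv (by simp [inner_sub_left])
  have hbound (t : ℝ) : HasDerivAt (fun s : ℝ ↦ L / 2 * ‖d‖ ^ 2 * s ^ 2)
      (L * ‖d‖ ^ 2 * t) t := by
    refine ((hasDerivAt_pow 2 t).const_mul (L / 2 * ‖d‖ ^ 2)).congr_deriv ?_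
    norm_num
    ring
  have key := image_norm_le_of_norm_deriv_right_le_deriv_boundary
    (a := (0 : ℝ)) (b := 1)
    (fun t _ ↦ (hderiv t).continuousAt.continuousWithinAt)
    (fun t _ ↦ (hderiv t).hasDerivWithinAt) (by simp) hbound
    (fun t ht ↦ by
      calc ‖⟪f' (x + t • d) - f' x, d⟫‖ ≤ ‖f' (x + t • d) - f' x‖ * ‖d‖ := norm_inner_le_norm _ _
        _ ≤ L * ‖x + t • d - x‖ * ‖d‖ := by gcongr; exact hlip _ _
        _ = L * ‖d‖ ^ 2 * t := by
          rw [add_sub_cancel_left, norm_smul, Real.norm_of_nonneg ht.1]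
          ring)
    (Set.right_mem_Icc.2 zero_le_one)
  simpa [hd] using key

/-- Inequality (35) of Lemma 8.5 (parallel updates): under the descent-ball
conditions for the SSC output `y` and the intermediate point `x̄`, and monotonicity
of the linearized progress, the decrease from `x` to `y` is at least a third of the
decrease from `x` to `x̄`. -/
theorem parallel_decrease_bound
    {E : Type*} [NormedAddCommGroup E] [InnerProductSpace ℝ E] [CompleteSpace E]
    (f : E → ℝ) (f' : E → E) (L : ℝ) (hL : 0 < L)
    (hdiff : ∀ z : E, HasGradientAt f (f' z) z)
    (hlip : ∀ z w : E, ‖f' z - f' w‖ ≤ L * ‖z - w‖)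
    (x xbar y : E)
    (hy : L * ‖y - x‖ ^ 2 ≤ ⟪-f' x, y - x⟫)
    (hxbar : L * ‖xbar - x‖ ^ 2 ≤ ⟪-f' x, xbar - x⟫)
    (hmono : ⟪-f' x, xbar - x⟫ ≤ ⟪-f' x, y - x⟫) :
    f x - f y ≥ 1 / 3 * (f x - f xbar) := by
  have hfy := (abs_le.1 (abs_sub_sub_inner_le_of_lipschitz_gradient hdiff hlip x y)).2
  have hfxbar := (abs_le.1 (abs_sub_sub_inner_le_of_lipschitz_gradient hdiff hlip x xbar)).1
  rw [inner_neg_left] at hy hxbar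
  rw [inner_neg_left, inner_neg_left] at hmono
  linarith
end
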